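/- For all n, k ≥ 1, the tree net T_Λ^{n,k} has decomposition width 2, i.e. there exists a wiring decomposition of T_Λ^{n,k} of width 2. -/

import Mathlib

/-! Core definitions: nets with boundaries (Sobocinski et al.),
composition, tensor, isomorphism, step firing semantics, ports,
connections, networks, bases, wiring expressions and decompositions. -/

namespace NWB

/-- A net with boundaries `N : k → l` (without the contention axioms,
which are packaged separately in `IsContention`). -/
structure NetB (k l : ℕ) : Type 1 where
  P : Type
  T : Type
  finP : Finite P
  finT : Finite T
  pre : T → Set P
  post : T → Set P
  src : T → Set (Fin k)
  tgt : T → Set (Fin l)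
  con : T → T → Prop

/-- The contention relation axioms: reflexive, symmetric, and forced whenever
two transitions share a pre-place, post-place, or boundary port. -/
def IsContention {k l : ℕ} (N : NetB k l) : Prop :=
  (∀ t, N.con t t) ∧ (∀ t u, N.con t u → N.con u t) ∧
  (∀ t u,
    ((N.pre t ∩ N.pre u).Nonempty ∨ (N.post t ∩ N.post u).Nonempty ∨
     (N.src t ∩ N.src u).Nonempty ∨ (N.tgt t ∩ N.tgt u).Nonempty) → N.con t u)

def setPre {k l : ℕ} (N : NetB k l) (U : Set N.T) : Set N.P := ⋃ u ∈ U, N.pre u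
def setPost {k l : ℕ} (N : NetB k l) (U : Set N.T) : Set N.P := ⋃ u ∈ U, N.post u
def setSrc {k l : ℕ} (N : NetB k l) (U : Set N.T) : Set (Fin k) := ⋃ u ∈ U, N.src u
def setTgt {k l : ℕ} (N : NetB k l) (U : Set N.T) : Set (Fin l) := ⋃ u ∈ U, N.tgt u

/-- Mutually independent set of transitions: no two distinct members in contention. -/
def MI {k l : ℕ} (N : NetB k l) (U : Set N.T) : Prop :=
  ∀ u ∈ U, ∀ v ∈ U, N.con u v → u = v

/-- Contention lifted to sets of transitions. -/
def setCon {k l : ℕ} (N : NetB k l) (U V : Set N.T) : Prop :=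
  ∃ u ∈ U, ∃ v ∈ V, N.con u v

/-- A synchronisation between `M : l → m` and `N : m → n`. -/
structure Sync {l m n : ℕ} (M : NetB l m) (N : NetB m n) where
  U : Set M.T
  V : Set N.T
  miU : MI M U
  miV : MI N V
  bd : setTgt M U = setSrc N V

def Sync.Trivial {l m n : ℕ} {M : NetB l m} {N : NetB m n} (s : Sync M N) : Prop :=
  s.U = ∅ ∧ s.V = ∅

/-- A minimal synchronisation: non-trivial, and every componentwise-smaller
synchronisation is trivial or equal to it. -/
def Sync.Minimal {l m n : ℕ} {M : NetB l m} {N : NetB m n} (s : Sync M N) : Prop :=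
  ¬ s.Trivial ∧
  ∀ s' : Sync M N, s'.U ⊆ s.U → s'.V ⊆ s.V → (s'.Trivial ∨ (s'.U = s.U ∧ s'.V = s.V))

theorem sync_finite {l m n : ℕ} (M : NetB l m) (N : NetB m n) : Finite (Sync M N) := by
  haveI := M.finT; haveI := N.finT
  apply Finite.of_injective (fun s : Sync M N => (s.U, s.V))
  intro s s' h
  simp only [Prod.mk.injEq] at h
  obtain ⟨h1, h2⟩ := h
  cases s; cases s'
  simp_all

/-- Composition along a common boundary. -/
def comp {l m n : ℕ} (M : NetB l m) (N : NetB m n) : NetB l n where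
  P := M.P ⊕ N.P
  T := {s : Sync M N // s.Minimal}
  finP := by haveI := M.finP; haveI := N.finP; exact inferInstance
  finT := by haveI := sync_finite M N; exact inferInstance
  pre s := (Sum.inl '' setPre M s.1.U) ∪ (Sum.inr '' setPre N s.1.V)
  post s := (Sum.inl '' setPost M s.1.U) ∪ (Sum.inr '' setPost N s.1.V)
  src s := setSrc M s.1.U
  tgt s := setTgt N s.1.V
  con s s' := setCon M s.1.U s'.1.U ∨ setCon N s.1.V s'.1.V

/-- Tensor product of nets with boundaries. -/
def tensor {l m k n : ℕ} (M : NetB l m) (N : NetB k n) : NetB (l + k) (m + n) where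
  P := M.P ⊕ N.P
  T := M.T ⊕ N.T
  finP := by haveI := M.finP; haveI := N.finP; exact inferInstance
  finT := by haveI := M.finT; haveI := N.finT; exact inferInstance
  pre t := match t with
    | Sum.inl t => Sum.inl '' M.pre t
    | Sum.inr t => Sum.inr '' N.pre t
  post t := match t with
    | Sum.inl t => Sum.inl '' M.post t
    | Sum.inr t => Sum.inr '' N.post t
  src t := match t with
    | Sum.inl t => Fin.castAdd k '' M.src t
    | Sum.inr t => Fin.natAdd l '' N.src t
  tgt t := match t with
    | Sum.inl t => Fin.castAdd n '' M.tgt t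
    | Sum.inr t => Fin.natAdd m '' N.tgt t
  con t u := match t, u with
    | Sum.inl t, Sum.inl u => M.con t u
    | Sum.inr t, Sum.inr u => N.con t u
    | _, _ => False

/-- Isomorphism of nets with boundaries: bijections on places and transitions
preserving pre-sets, post-sets, boundary maps and contention. -/
structure NetIso {k l : ℕ} (M N : NetB k l) where
  ep : M.P ≃ N.P
  et : M.T ≃ N.T
  pre_eq : ∀ t, N.pre (et t) = ep '' M.pre t
  post_eq : ∀ t, N.post (et t) = ep '' M.post t
  src_eq : ∀ t, N.src (et t) = M.src t
  tgt_eq : ∀ t, N.tgt (et t) = M.tgt t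
  con_iff : ∀ t u, N.con (et t) (et u) ↔ M.con t u

def Iso {k l : ℕ} (M N : NetB k l) : Prop := Nonempty (NetIso M N)

/-- Transport a net along equalities of its boundary sizes. -/
def castNet {k l k' l' : ℕ} (h1 : k = k') (h2 : l = l') (N : NetB k l) : NetB k' l' where
  P := N.P
  T := N.T
  finP := N.finP
  finT := N.finT
  pre := N.pre
  post := N.post
  src t := Fin.cast h1 '' N.src t
  tgt t := Fin.cast h2 '' N.tgt t
  con := N.con

def emptyNet : NetB 0 0 where
  P := Empty
  T := Empty
  finP := inferInstance
  finT := inferInstance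
  pre t := t.elim
  post t := t.elim
  src t := t.elim
  tgt t := t.elim
  con t _ := t.elim

/-- The step firing semantics: `Fires N X X' α β` iff the LTS `⟦N⟧` has a
transition `X →⟨α,β⟩ X'`. -/
def Fires {k l : ℕ} (N : NetB k l) (X X' : Set N.P) (α : Set (Fin k)) (β : Set (Fin l)) :
    Prop :=
  ∃ U : Set N.T, MI N U ∧ setPre N U ⊆ X ∧ setPost N U ∩ X = ∅ ∧
    X' = (X \ setPre N U) ∪ setPost N U ∧ setSrc N U = α ∧ setTgt N U = β

/-! ### Ports, connections and networks -/

/-- The ports of a net: an in-port and an out-port for each place,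
together with the left and right boundary ports. -/
def Port {k l : ℕ} (N : NetB k l) : Type := (N.P ⊕ N.P) ⊕ (Fin k ⊕ Fin l)

def portIn {k l : ℕ} {N : NetB k l} (p : N.P) : Port N := Sum.inl (Sum.inl p)
def portOut {k l : ℕ} {N : NetB k l} (p : N.P) : Port N := Sum.inl (Sum.inr p)
def bLeft {k l : ℕ} {N : NetB k l} (i : Fin k) : Port N := Sum.inr (Sum.inl i)
def bRight {k l : ℕ} {N : NetB k l} (j : Fin l) : Port N := Sum.inr (Sum.inr j)

/-- The portset of a transition. -/
def tports {k l : ℕ} (N : NetB k l) (t : N.T) : Set (Port N) :=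
  (portOut '' N.pre t) ∪ (portIn '' N.post t) ∪ (bLeft '' N.src t) ∪ (bRight '' N.tgt t)

/-- The connection of a port `q`: the portsets (minus `q`) of all transitions
properly connecting to `q`. -/
def conn {k l : ℕ} (N : NetB k l) (q : Port N) : Set (Set (Port N)) :=
  { K | ∃ t : N.T, {q} ⊂ tports N t ∧ K = tports N t \ {q} }

/-- The connection of `q` restricted to a set `R` of ports. -/
def connR {k l : ℕ} (N : NetB k l) (R : Set (Port N)) (q : Port N) :
    Set (Set (Port N)) :=
  { K' | ∃ K ∈ conn N q, (K ∩ R).Nonempty ∧ K' = K ∩ R }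

/-- Extended ports of the left part of an oriented partition. -/
def eportsL {k l : ℕ} (N : NetB k l) (Pl : Set N.P) : Set (Port N) :=
  (portIn '' Pl) ∪ (portOut '' Pl) ∪ Set.range (bLeft (N := N))

/-- Extended ports of the right part of an oriented partition. -/
def eportsR {k l : ℕ} (N : NetB k l) (Pr : Set N.P) : Set (Port N) :=
  (portIn '' Pr) ∪ (portOut '' Pr) ∪ Set.range (bRight (N := N))

/-- The network `net(P_l → P_r)`. -/
def networkLR {k l : ℕ} (N : NetB k l) (Pl Pr : Set N.P) :
    Set (Set (Set (Port N))) :=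
  { c | ∃ q ∈ eportsL N Pl, c = connR N (eportsR N Pr) q }

/-- The network `net(P_r → P_l)`. -/
def networkRL {k l : ℕ} (N : NetB k l) (Pl Pr : Set N.P) :
    Set (Set (Set (Port N))) :=
  { c | ∃ q ∈ eportsR N Pr, c = connR N (eportsL N Pl) q }

/-- `b` is a basis of the network `M`: every connection in `M` is a union of
basis connections. -/
def IsBasis {C : Type} {m : ℕ} (b : Fin m → Set C) (M : Set (Set C)) : Prop :=
  ∀ c ∈ M, ∃ S : Finset (Fin m), c = ⋃ i ∈ S, b i

/-- The dimension of a network: the size of its smallest basis. -/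
noncomputable def netDim {C : Type} (M : Set (Set C)) : ℕ :=
  sInf { m | ∃ b : Fin m → Set C, IsBasis b M }

/-- Purity of a composition `N_l ; N_r`: no transition of either component
connects to two different shared boundary ports. -/
def Pure {k n l : ℕ} (Nl : NetB k n) (Nr : NetB n l) : Prop :=
  (∀ j : Fin n, ∀ K ∈ conn Nl (bRight j), ∀ i : Fin n, bRight i ∉ K) ∧
  (∀ j : Fin n, ∀ K ∈ conn Nr (bLeft j), ∀ i : Fin n, bLeft i ∉ K)

/-! ### Wiring expressions and decompositions -/

/-- Nets with boundaries of arbitrary boundary sizes. -/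
def NetS : Type 1 := Σ (k : ℕ) (l : ℕ), NetB k l

/-- Composition on `NetS` (junk value on boundary mismatch). -/
def seqS (X Y : NetS) : NetS :=
  if h : X.2.1 = Y.1 then ⟨X.1, Y.2.1, comp (castNet rfl h X.2.2) Y.2.2⟩
  else ⟨0, 0, emptyNet⟩

def tenS (X Y : NetS) : NetS := ⟨X.1 + Y.1, X.2.1 + Y.2.1, tensor X.2.2 Y.2.2⟩

/-- Wiring expressions: binary trees with `;` and `⊗` nodes and variables at
the leaves. -/
inductive WExpr (V : Type) : Type
  | leaf : V → WExpr V
  | seq : WExpr V → WExpr V → WExpr V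
  | ten : WExpr V → WExpr V → WExpr V

/-- Semantics of a wiring expression under a variable assignment. -/
def sem {V : Type} (A : V → NetS) : WExpr V → NetS
  | .leaf x => A x
  | .seq t₁ t₂ => seqS (sem A t₁) (sem A t₂)
  | .ten t₁ t₂ => tenS (sem A t₁) (sem A t₂)

/-- Compatibility of an assignment with an expression: at each `;` node the
shared boundaries match. -/
def WT {V : Type} (A : V → NetS) : WExpr V → Prop
  | .leaf _ => True
  | .seq t₁ t₂ => WT A t₁ ∧ WT A t₂ ∧ (sem A t₁).2.1 = (sem A t₂).1
  | .ten t₁ t₂ => WT A t₁ ∧ WT A t₂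

/-- The wiring decomposition `(t, A)` has width `w`: every leaf net has
boundaries and number of places `≤ w`, and every subexpression has
boundaries `≤ w`. -/
def HasWidth {V : Type} (A : V → NetS) (w : ℕ) : WExpr V → Prop
  | .leaf x => (A x).1 ≤ w ∧ Nat.card (A x).2.2.P ≤ w ∧ (A x).2.1 ≤ w
  | .seq t₁ t₂ => HasWidth A w t₁ ∧ HasWidth A w t₂ ∧
      (sem A (.seq t₁ t₂)).1 ≤ w ∧ (sem A (.seq t₁ t₂)).2.1 ≤ w
  | .ten t₁ t₂ => HasWidth A w t₁ ∧ HasWidth A w t₂ ∧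
      (sem A (.ten t₁ t₂)).1 ≤ w ∧ (sem A (.ten t₁ t₂)).2.1 ≤ w

/-- `(t, A)` is a wiring decomposition of `N : k → l`: the assignment maps
variables to genuine nets with boundaries, is compatible with `t`, and
`⟦t⟧_A ≅ N`. -/
def IsDecompOf {V : Type} {k l : ℕ} (A : V → NetS) (t : WExpr V) (N : NetB k l) : Prop :=
  (∀ x, IsContention (A x).2.2) ∧ WT A t ∧
  ∃ (h1 : (sem A t).1 = k) (h2 : (sem A t).2.1 = l),
    Iso (castNet h1 h2 (sem A t).2.2) N

/-- A net has decomposition width `w` if it has a wiring decomposition of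
width `w`. -/
def HasDecompWidth {k l : ℕ} (N : NetB k l) (w : ℕ) : Prop :=
  ∃ (Var : Type) (A : Var → NetS) (t : WExpr Var),
    IsDecompOf A t N ∧ HasWidth A w t

/-- A pure wiring decomposition: at every `;` node the composition of the two
subexpression nets is pure. -/
def PureExpr {V : Type} (A : V → NetS) : WExpr V → Prop
  | .leaf _ => True
  | .seq t₁ t₂ => PureExpr A t₁ ∧ PureExpr A t₂ ∧
      ∀ (h : (sem A t₁).2.1 = (sem A t₂).1),
        Pure (castNet rfl h (sem A t₁).2.2) (sem A t₂).2.2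
  | .ten t₁ t₂ => PureExpr A t₁ ∧ PureExpr A t₂

/-- One step of reassociation of `;` or `⊗`, anywhere inside an expression. -/
inductive AssocStep {V : Type} : WExpr V → WExpr V → Prop
  | seqAssoc (a b c : WExpr V) : AssocStep (.seq (.seq a b) c) (.seq a (.seq b c))
  | tenAssoc (a b c : WExpr V) : AssocStep (.ten (.ten a b) c) (.ten a (.ten b c))
  | seqCongrL {a a' : WExpr V} (b : WExpr V) :
      AssocStep a a' → AssocStep (.seq a b) (.seq a' b)
  | seqCongrR (a : WExpr V) {b b' : WExpr V} :
      AssocStep b b' → AssocStep (.seq a b) (.seq a b')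
  | tenCongrL {a a' : WExpr V} (b : WExpr V) :
      AssocStep a a' → AssocStep (.ten a b) (.ten a' b)
  | tenCongrR (a : WExpr V) {b b' : WExpr V} :
      AssocStep b b' → AssocStep (.ten a b) (.ten a b')

/-- Equivalence of wiring expressions up to associativity of `;` and `⊗`. -/
def AssocEquiv {V : Type} : WExpr V → WExpr V → Prop := Relation.EqvGen AssocStep

/-! ### Concrete families of nets -/

/-- The clique net `C_n : 0 → 0`, with the minimal contention relation. -/
def clique (n : ℕ) : NetB 0 0 where
  P := Fin n
  T := {p : Fin n × Fin n // p.1 ≠ p.2}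
  finP := inferInstance
  finT := inferInstance
  pre t := {t.1.1}
  post t := {t.1.2}
  src _ := ∅
  tgt _ := ∅
  con t u := t.1.1 = u.1.1 ∨ t.1.2 = u.1.2

/-- The subset net `P_n : 0 → 0`: a place `S` (= `none`), places `[n]`, and for
each `A ⊆ [n]` a transition `S → A`; the minimal contention relation is total
since all pre-sets are `{S}`. -/
def subsetNet (n : ℕ) : NetB 0 0 where
  P := Option (Fin n)
  T := Set (Fin n)
  finP := inferInstance
  finT := inferInstance
  pre _ := {none}
  post A := some '' A
  src _ := ∅
  tgt _ := ∅
  con _ _ := True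

/-- The tree net `T_Δ^{n,k} : 0 → 0`: places are nodes of the complete n-ary
tree of depth k (lists over `Fin n` of length ≤ k); each non-leaf node has a
single transition to the set of its n children. The minimal contention
relation is equality. -/
def treeD (n k : ℕ) : NetB 0 0 where
  P := {l : List (Fin n) // l.length ≤ k}
  T := {l : List (Fin n) // l.length < k}
  finP := (List.finite_length_le (Fin n) k).to_subtype
  finT := (List.finite_length_lt (Fin n) k).to_subtype
  pre t := {⟨t.1, t.2.le⟩}
  post t := {p | ∃ i : Fin n, p.1 = t.1 ++ [i]}
  src _ := ∅
  tgt _ := ∅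
  con t u := t = u

/-- The tree net `T_Λ^{n,k} : 0 → 0`: as `T_Δ^{n,k}` but with a separate
transition from each non-leaf node to each of its children. The minimal
contention relation relates transitions with the same parent node. -/
def treeL (n k : ℕ) : NetB 0 0 where
  P := {l : List (Fin n) // l.length ≤ k}
  T := {l : List (Fin n) // l.length < k} × Fin n
  finP := (List.finite_length_le (Fin n) k).to_subtype
  finT := by
    haveI : Finite {l : List (Fin n) // l.length < k} :=
      (List.finite_length_lt (Fin n) k).to_subtype
    exact inferInstance
  pre t := {⟨t.1.1, t.1.2.le⟩}
  post t := {p | p.1 = t.1.1 ++ [t.2]}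
  src _ := ∅
  tgt _ := ∅
  con t u := t.1 = u.1

/-- The grid net `G_n : 0 → 0`: places `[n] × [n]`, a transition from each
place to its right neighbour and to its lower neighbour; the minimal
contention relation relates transitions sharing a pre-place or post-place. -/
def grid (n : ℕ) : NetB 0 0 where
  P := Fin n × Fin n
  T := {e : (Fin n × Fin n) × (Fin n × Fin n) //
        (e.2.1 = e.1.1 ∧ (e.2.2 : ℕ) = (e.1.2 : ℕ) + 1) ∨
        ((e.2.1 : ℕ) = (e.1.1 : ℕ) + 1 ∧ e.2.2 = e.1.2)}
  finP := inferInstance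
  finT := inferInstance
  pre e := {e.1.1}
  post e := {e.1.2}
  src _ := ∅
  tgt _ := ∅
  con t u := t.1.1 = u.1.1 ∨ t.1.2 = u.1.2

end NWB

namespace NWB

theorem castNet_self {k l : ℕ} (N : NetB k l) (h1 : k = k) (h2 : l = l) :
    castNet h1 h2 N = N := by
  cases N
  simp [castNet]

/-! ### Isomorphisms -/

def NetIso.symm {k l : ℕ} {M N : NetB k l} (φ : NetIso M N) : NetIso N M where
  ep := φ.ep.symm
  et := φ.et.symm
  pre_eq t := by
    have := φ.pre_eq (φ.et.symm t)
    rw [Equiv.apply_symm_apply] at this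
    rw [this, Equiv.symm_image_image]
  post_eq t := by
    have := φ.post_eq (φ.et.symm t)
    rw [Equiv.apply_symm_apply] at this
    rw [this, Equiv.symm_image_image]
  src_eq t := by
    have := φ.src_eq (φ.et.symm t)
    rw [Equiv.apply_symm_apply] at this
    exact this.symm
  tgt_eq t := by
    have := φ.tgt_eq (φ.et.symm t)
    rw [Equiv.apply_symm_apply] at this
    exact this.symm
  con_iff t u := by
    have := φ.con_iff (φ.et.symm t) (φ.et.symm u)
    simp only [Equiv.apply_symm_apply] at this
    exact this.symm

def NetIso.trans {k l : ℕ} {M N K : NetB k l} (φ : NetIso M N) (ψ : NetIso N K) :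
    NetIso M K where
  ep := φ.ep.trans ψ.ep
  et := φ.et.trans ψ.et
  pre_eq t := by simp [ψ.pre_eq, φ.pre_eq, Set.image_image]
  post_eq t := by simp [ψ.post_eq, φ.post_eq, Set.image_image]
  src_eq t := by simp [ψ.src_eq, φ.src_eq]
  tgt_eq t := by simp [ψ.tgt_eq, φ.tgt_eq]
  con_iff t u := by simp [ψ.con_iff, φ.con_iff]

def NetIso.refl {k l : ℕ} (M : NetB k l) : NetIso M M where
  ep := Equiv.refl _
  et := Equiv.refl _
  pre_eq t := by simp
  post_eq t := by simp
  src_eq t := by simp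
  tgt_eq t := by simp
  con_iff t u := by simp

def NetIso.tensor {l m k n : ℕ} {M M' : NetB l m} {N N' : NetB k n}
    (φ : NetIso M M') (ψ : NetIso N N') : NetIso (NWB.tensor M N) (NWB.tensor M' N') where
  ep := Equiv.sumCongr φ.ep ψ.ep
  et := Equiv.sumCongr φ.et ψ.et
  pre_eq t := by
    rcases t with t | t
    · change Sum.inl '' M'.pre (φ.et t) = Sum.map φ.ep ψ.ep '' (Sum.inl '' M.pre t)
      rw [φ.pre_eq, Set.image_image, Set.image_image]; rfl
    · change Sum.inr '' N'.pre (ψ.et t) = Sum.map φ.ep ψ.ep '' (Sum.inr '' N.pre t)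
      rw [ψ.pre_eq, Set.image_image, Set.image_image]; rfl
  post_eq t := by
    rcases t with t | t
    · change Sum.inl '' M'.post (φ.et t) = Sum.map φ.ep ψ.ep '' (Sum.inl '' M.post t)
      rw [φ.post_eq, Set.image_image, Set.image_image]; rfl
    · change Sum.inr '' N'.post (ψ.et t) = Sum.map φ.ep ψ.ep '' (Sum.inr '' N.post t)
      rw [ψ.post_eq, Set.image_image, Set.image_image]; rfl
  src_eq t := by
    rcases t with t | t
    · exact congrArg (Fin.castAdd k '' ·) (φ.src_eq t)
    · exact congrArg (Fin.natAdd l '' ·) (ψ.src_eq t)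
  tgt_eq t := by
    rcases t with t | t
    · exact congrArg (Fin.castAdd n '' ·) (φ.tgt_eq t)
    · exact congrArg (Fin.natAdd m '' ·) (ψ.tgt_eq t)
  con_iff t u := by
    rcases t with t | t <;> rcases u with u | u
    · exact φ.con_iff t u
    · exact Iff.rfl
    · exact Iff.rfl
    · exact ψ.con_iff t u

section congr
variable {l m n : ℕ} {M : NetB l m} {N N' : NetB m n}

theorem Sync.ext' {s s' : Sync M N} (h1 : s.U = s'.U) (h2 : s.V = s'.V) : s = s' := by
  cases s; cases s'; simp_all

theorem setSrc_image (φ : NetIso N N') (V : Set N.T) :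
    setSrc N' (φ.et '' V) = setSrc N V := by
  simp only [setSrc, Set.biUnion_image, φ.src_eq]

theorem setTgt_image (φ : NetIso N N') (V : Set N.T) :
    setTgt N' (φ.et '' V) = setTgt N V := by
  simp only [setTgt, Set.biUnion_image, φ.tgt_eq]

theorem setPre_image (φ : NetIso N N') (V : Set N.T) :
    setPre N' (φ.et '' V) = φ.ep '' setPre N V := by
  simp only [setPre, Set.biUnion_image, φ.pre_eq, Set.image_iUnion]

theorem setPost_image (φ : NetIso N N') (V : Set N.T) :
    setPost N' (φ.et '' V) = φ.ep '' setPost N V := by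
  simp only [setPost, Set.biUnion_image, φ.post_eq, Set.image_iUnion]

theorem setCon_image (φ : NetIso N N') (V W : Set N.T) :
    setCon N' (φ.et '' V) (φ.et '' W) ↔ setCon N V W := by
  simp only [setCon, Set.exists_mem_image, φ.con_iff]

def Sync.map (φ : NetIso N N') (s : Sync M N) : Sync M N' where
  U := s.U
  V := φ.et '' s.V
  miU := s.miU
  miV := by
    rintro _ ⟨u, hu, rfl⟩ _ ⟨v, hv, rfl⟩ h
    rw [s.miV u hu v hv ((φ.con_iff u v).1 h)]
  bd := by rw [setSrc_image, s.bd]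

theorem Sync.map_symm_map (φ : NetIso N N') (s : Sync M N) : (s.map φ).map φ.symm = s :=
  Sync.ext' rfl (by simp [Sync.map, NetIso.symm])

theorem Sync.map_map_symm (φ : NetIso N N') (s : Sync M N') : (s.map φ.symm).map φ = s :=
  Sync.ext' rfl (by simp [Sync.map, NetIso.symm])

theorem Sync.trivial_map (φ : NetIso N N') (s : Sync M N) :
    (s.map φ).Trivial ↔ s.Trivial := by
  simp [Sync.Trivial, Sync.map]

theorem Sync.minimal_map (φ : NetIso N N') (s : Sync M N) (h : s.Minimal) :
    (s.map φ).Minimal := by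
  refine ⟨fun h' => h.1 ((Sync.trivial_map φ s).1 h'), fun s' hU hV => ?_⟩
  obtain ⟨r, rfl⟩ : ∃ r : Sync M N, s' = r.map φ := ⟨s'.map φ.symm, (Sync.map_map_symm φ s').symm⟩
  rw [Sync.trivial_map]
  have hV' : r.V ⊆ s.V := by
    have : φ.et '' r.V ⊆ φ.et '' s.V := hV
    exact (Set.image_subset_image_iff φ.et.injective).1 this
  rcases h.2 r hU hV' with h | ⟨h1, h2⟩
  · exact Or.inl h
  · exact Or.inr ⟨h1, by simp [Sync.map, h2]⟩

def NetIso.compRight (M : NetB l m) (φ : NetIso N N') : NetIso (comp M N) (comp M N') where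
  ep := Equiv.sumCongr (Equiv.refl _) φ.ep
  et :=
    { toFun := fun s => ⟨s.1.map φ, s.1.minimal_map φ s.2⟩
      invFun := fun s => ⟨s.1.map φ.symm, s.1.minimal_map φ.symm s.2⟩
      left_inv := fun s => Subtype.ext (Sync.map_symm_map φ s.1)
      right_inv := fun s => Subtype.ext (Sync.map_map_symm φ s.1) }
  pre_eq t := by
    change Sum.inl '' setPre M t.1.U ∪ Sum.inr '' setPre N' (φ.et '' t.1.V) =
      Sum.map id φ.ep '' (Sum.inl '' setPre M t.1.U ∪ Sum.inr '' setPre N t.1.V)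
    rw [setPre_image, Set.image_union, Set.image_image, Set.image_image, Set.image_image]; rfl
  post_eq t := by
    change Sum.inl '' setPost M t.1.U ∪ Sum.inr '' setPost N' (φ.et '' t.1.V) =
      Sum.map id φ.ep '' (Sum.inl '' setPost M t.1.U ∪ Sum.inr '' setPost N t.1.V)
    rw [setPost_image, Set.image_union, Set.image_image, Set.image_image, Set.image_image]; rfl
  src_eq t := rfl
  tgt_eq t := setTgt_image φ t.1.V
  con_iff t u := or_congr Iff.rfl (setCon_image φ t.1.V u.1.V)

end congr

/-! ### Compositions where each transition uses at most one shared port -/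

section pure
variable {l m n : ℕ} {M : NetB l m} {N : NetB m n}

/-- Codes of minimal synchronisations. -/
def Valid (tg : M.T → Option (Fin m)) (sr : N.T → Option (Fin m)) :
    Option M.T × Option N.T → Prop
  | (none, none) => False
  | (some u, none) => tg u = none
  | (none, some v) => sr v = none
  | (some u, some v) => ∃ j, tg u = some j ∧ sr v = some j

theorem valid_bd {tg : M.T → Option (Fin m)} (htg : ∀ u j, j ∈ M.tgt u ↔ tg u = some j)
    {sr : N.T → Option (Fin m)} (hsr : ∀ v j, j ∈ N.src v ↔ sr v = some j)
    (x : Option M.T × Option N.T) (hx : Valid tg sr x) :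
    setTgt M {u | x.1 = some u} = setSrc N {v | x.2 = some v} := by
  ext j
  rcases x with ⟨_ | u, _ | v⟩ <;> simp [Valid] at hx <;> simp [setTgt, setSrc, htg, hsr]
  · simp [hx]
  · simp [hx]
  · obtain ⟨i, h1, h2⟩ := hx
    simp [h1, h2]

def codeSync {tg : M.T → Option (Fin m)} (htg : ∀ u j, j ∈ M.tgt u ↔ tg u = some j)
    {sr : N.T → Option (Fin m)} (hsr : ∀ v j, j ∈ N.src v ↔ sr v = some j)
    (x : Option M.T × Option N.T) (hx : Valid tg sr x) : Sync M N where
  U := {u | x.1 = some u}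
  V := {v | x.2 = some v}
  miU := by
    intro u hu v hv _
    simp only [Set.mem_setOf_eq] at hu hv
    simpa [hu] using hv
  miV := by
    intro u hu v hv _
    simp only [Set.mem_setOf_eq] at hu hv
    simpa [hu] using hv
  bd := valid_bd htg hsr x hx

theorem codeSync_minimal {tg : M.T → Option (Fin m)}
    (htg : ∀ u j, j ∈ M.tgt u ↔ tg u = some j)
    {sr : N.T → Option (Fin m)} (hsr : ∀ v j, j ∈ N.src v ↔ sr v = some j)
    (x : Option M.T × Option N.T) (hx : Valid tg sr x) :
    (codeSync htg hsr x hx).Minimal := by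
  constructor
  · rintro ⟨h1, h2⟩
    rcases x with ⟨_ | u, _ | v⟩
    · exact hx
    · have : v ∈ (∅ : Set N.T) := h2 ▸ (rfl : some v = some v)
      exact this
    · have : u ∈ (∅ : Set M.T) := h1 ▸ (rfl : some u = some u)
      exact this
    · have : u ∈ (∅ : Set M.T) := h1 ▸ (rfl : some u = some u)
      exact this
  · rintro ⟨U, V, _, _, bd⟩ hU hV
    simp only [Sync.Trivial, codeSync] at hU hV ⊢
    rcases x with ⟨_ | u, _ | v⟩
    · exact hx.elim
    · have hU0 : U = ∅ := by ext a; simpa using fun h => by simpa using hU h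
      have hV' : V ⊆ {v} := fun a h => by simpa [eq_comm] using hV h
      rcases Set.subset_singleton_iff_eq.1 hV' with h | h
      · exact Or.inl ⟨hU0, h⟩
      · exact Or.inr ⟨by simp [hU0], by ext a; simp [h, eq_comm]⟩
    · have hV0 : V = ∅ := by ext a; simpa using fun h => by simpa using hV h
      have hU' : U ⊆ {u} := fun a h => by simpa [eq_comm] using hU h
      rcases Set.subset_singleton_iff_eq.1 hU' with h | h
      · exact Or.inl ⟨h, hV0⟩
      · exact Or.inr ⟨by ext a; simp [h, eq_comm], by simp [hV0]⟩
    · obtain ⟨j, h1, h2⟩ := hx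
      have hV' : V ⊆ {v} := fun a h => by simpa [eq_comm] using hV h
      have hU' : U ⊆ {u} := fun a h => by simpa [eq_comm] using hU h
      have hj := Set.ext_iff.1 bd j
      rcases Set.subset_singleton_iff_eq.1 hV' with h | h <;>
        rcases Set.subset_singleton_iff_eq.1 hU' with h' | h'
      · exact Or.inl ⟨h', h⟩
      · simp [h, h', setTgt, setSrc, htg, h1] at hj
      · simp [h, h', setTgt, setSrc, hsr, h2] at hj
      · exact Or.inr ⟨by ext a; simp [h', eq_comm], by ext a; simp [h, eq_comm]⟩

theorem exists_code {tg : M.T → Option (Fin m)}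
    (htg : ∀ u j, j ∈ M.tgt u ↔ tg u = some j)
    {sr : N.T → Option (Fin m)} (hsr : ∀ v j, j ∈ N.src v ↔ sr v = some j)
    (s : Sync M N) (hs : s.Minimal) : ∃ x, ∃ hx : Valid tg sr x, codeSync htg hsr x hx = s := by
  suffices h : ∃ x, ∃ hx : Valid tg sr x, (codeSync htg hsr x hx).U ⊆ s.U ∧
      (codeSync htg hsr x hx).V ⊆ s.V by
    obtain ⟨x, hx, h1, h2⟩ := h
    refine ⟨x, hx, ?_⟩
    rcases hs.2 _ h1 h2 with h | h
    · exact ((codeSync_minimal htg hsr x hx).1 h).elim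
    · exact Sync.ext' h.1 h.2
  have key : ∀ j, (∃ u ∈ s.U, tg u = some j) ↔ ∃ v ∈ s.V, sr v = some j := by
    intro j
    have := Set.ext_iff.1 s.bd j
    simpa [setTgt, setSrc, htg, hsr] using this
  have pair : ∀ u ∈ s.U, ∀ v ∈ s.V, ∀ j, tg u = some j → sr v = some j →
      ∃ x, ∃ hx : Valid tg sr x, (codeSync htg hsr x hx).U ⊆ s.U ∧
      (codeSync htg hsr x hx).V ⊆ s.V := by
    intro u hu v hv j h1 h2
    refine ⟨(some u, some v), ⟨j, h1, h2⟩, ?_, ?_⟩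
    · intro a ha
      obtain rfl : u = a := by simpa [codeSync, eq_comm] using ha
      exact hu
    · intro a ha
      obtain rfl : v = a := by simpa [codeSync, eq_comm] using ha
      exact hv
  by_cases hU : s.U = ∅
  · have hV : s.V.Nonempty := by
      rw [Set.nonempty_iff_ne_empty]
      exact fun h => hs.1 ⟨hU, h⟩
    obtain ⟨v, hv⟩ := hV
    rcases hsv : sr v with _ | j
    · refine ⟨(none, some v), hsv, ?_, ?_⟩
      · intro a ha
        simp [codeSync] at ha
      · intro a ha
        obtain rfl : v = a := by simpa [codeSync, eq_comm] using ha
        exact hv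
    · obtain ⟨u, hu, h⟩ := (key j).2 ⟨v, hv, hsv⟩
      exact pair u hu v hv j h hsv
  · obtain ⟨u, hu⟩ := Set.nonempty_iff_ne_empty.2 hU
    rcases htu : tg u with _ | j
    · refine ⟨(some u, none), htu, ?_, ?_⟩
      · intro a ha
        obtain rfl : u = a := by simpa [codeSync, eq_comm] using ha
        exact hu
      · intro a ha
        simp [codeSync] at ha
    · obtain ⟨v, hv, h⟩ := (key j).1 ⟨u, hu, htu⟩
      exact pair u hu v hv j htu h

theorem comp_iso {K : NetB l n} (tg : M.T → Option (Fin m))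
    (htg : ∀ u j, j ∈ M.tgt u ↔ tg u = some j)
    (sr : N.T → Option (Fin m)) (hsr : ∀ v j, j ∈ N.src v ↔ sr v = some j)
    (ep : M.P ⊕ N.P ≃ K.P) (f : K.T → Option M.T × Option N.T)
    (finj : Function.Injective f) (fval : ∀ t, Valid tg sr (f t))
    (fsurj : ∀ x, Valid tg sr x → ∃ t, f t = x)
    (pre1 : ∀ t p, ep (Sum.inl p) ∈ K.pre t ↔ ∃ u, (f t).1 = some u ∧ p ∈ M.pre u)
    (pre2 : ∀ t p, ep (Sum.inr p) ∈ K.pre t ↔ ∃ u, (f t).2 = some u ∧ p ∈ N.pre u)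
    (post1 : ∀ t p, ep (Sum.inl p) ∈ K.post t ↔ ∃ u, (f t).1 = some u ∧ p ∈ M.post u)
    (post2 : ∀ t p, ep (Sum.inr p) ∈ K.post t ↔ ∃ u, (f t).2 = some u ∧ p ∈ N.post u)
    (hsrc : ∀ t i, i ∈ K.src t ↔ ∃ u, (f t).1 = some u ∧ i ∈ M.src u)
    (htgt : ∀ t i, i ∈ K.tgt t ↔ ∃ u, (f t).2 = some u ∧ i ∈ N.tgt u)
    (hcon : ∀ t t', K.con t t' ↔
      (∃ u u', (f t).1 = some u ∧ (f t').1 = some u' ∧ M.con u u') ∨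
      (∃ u u', (f t).2 = some u ∧ (f t').2 = some u' ∧ N.con u u')) :
    Iso (comp M N) K := by
  have hbij : Function.Bijective (fun t : K.T => (⟨codeSync htg hsr (f t) (fval t),
      codeSync_minimal htg hsr _ _⟩ : (comp M N).T)) := by
    constructor
    · intro t t' h
      apply finj
      have h0 := congrArg Subtype.val h
      have h1 : ∀ u, (f t).1 = some u ↔ (f t').1 = some u := Set.ext_iff.1 (congrArg Sync.U h0)
      have h2 : ∀ u, (f t).2 = some u ↔ (f t').2 = some u := Set.ext_iff.1 (congrArg Sync.V h0)
      exact Prod.ext (Option.ext h1) (Option.ext h2)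
    · rintro ⟨s, hs⟩
      obtain ⟨x, hx, rfl⟩ := exists_code htg hsr s hs
      obtain ⟨t, rfl⟩ := fsurj x hx
      exact ⟨t, rfl⟩
  refine ⟨NetIso.symm (M := K) (N := comp M N)
    { ep := ep.symm, et := Equiv.ofBijective _ hbij, pre_eq := ?_, post_eq := ?_, src_eq := ?_,
      tgt_eq := ?_, con_iff := ?_ }⟩
  · intro t
    change Sum.inl '' setPre M {u | (f t).1 = some u} ∪
      Sum.inr '' setPre N {v | (f t).2 = some v} = ep.symm '' K.pre t
    ext p
    rw [Equiv.image_symm_eq_preimage, Set.mem_preimage]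
    rcases p with p | p
    · rw [pre1]; simp [setPre]
    · rw [pre2]; simp [setPre]
  · intro t
    change Sum.inl '' setPost M {u | (f t).1 = some u} ∪
      Sum.inr '' setPost N {v | (f t).2 = some v} = ep.symm '' K.post t
    ext p
    rw [Equiv.image_symm_eq_preimage, Set.mem_preimage]
    rcases p with p | p
    · rw [post1]; simp [setPost]
    · rw [post2]; simp [setPost]
  · intro t
    change setSrc M {u | (f t).1 = some u} = K.src t
    ext i
    simp [setSrc, hsrc]
  · intro t
    change setTgt N {v | (f t).2 = some v} = K.tgt t
    ext i
    simp [setTgt, htgt]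
  · intro t u
    change (setCon M {a | (f t).1 = some a} {a | (f u).1 = some a} ∨
      setCon N {a | (f t).2 = some a} {a | (f u).2 = some a}) ↔ K.con t u
    simp [setCon, hcon]
end pure

/-! ### The nets used in the decomposition -/

abbrev tensorA {l m k n : ℕ} (M : NetB l m) (N : NetB k n) : NetB (l + k) (m + n) where
  P := M.P ⊕ N.P
  T := M.T ⊕ N.T
  finP := by haveI := M.finP; haveI := N.finP; exact inferInstance
  finT := by haveI := M.finT; haveI := N.finT; exact inferInstance
  pre t := match t with
    | Sum.inl t => Sum.inl '' M.pre t
    | Sum.inr t => Sum.inr '' N.pre t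
  post t := match t with
    | Sum.inl t => Sum.inl '' M.post t
    | Sum.inr t => Sum.inr '' N.post t
  src t := match t with
    | Sum.inl t => Fin.castAdd k '' M.src t
    | Sum.inr t => Fin.natAdd l '' N.src t
  tgt t := match t with
    | Sum.inl t => Fin.castAdd n '' M.tgt t
    | Sum.inr t => Fin.natAdd m '' N.tgt t
  con t u := match t, u with
    | Sum.inl t, Sum.inl u => M.con t u
    | Sum.inr t, Sum.inr u => N.con t u
    | _, _ => False

abbrev treeA (n k : ℕ) : NetB 0 0 where
  P := {l : List (Fin n) // l.length ≤ k}
  T := {l : List (Fin n) // l.length < k} × Fin n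
  finP := (List.finite_length_le (Fin n) k).to_subtype
  finT := by
    haveI : Finite {l : List (Fin n) // l.length < k} :=
      (List.finite_length_lt (Fin n) k).to_subtype
    exact inferInstance
  pre t := {⟨t.1.1, t.1.2.le⟩}
  post t := {p | p.1 = t.1.1 ++ [t.2]}
  src _ := ∅
  tgt _ := ∅
  con t u := t.1 = u.1

/-- A rooted net all of whose transitions have one source and one target place. -/
structure Dat : Type 1 where
  P : Type
  I : Type
  finP : Finite P
  finI : Finite I
  s : I → P
  t : I → P
  r : P

/-- The net of `X` with `b` extra transitions from the boundary to the root. -/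
abbrev Gb (b : ℕ) (X : Dat) : NetB b 0 where
  P := X.P
  T := X.I ⊕ Fin b
  finP := X.finP
  finT := by haveI := X.finI; exact inferInstance
  pre t := match t with
    | .inl i => {X.s i}
    | .inr _ => ∅
  post t := match t with
    | .inl i => {X.t i}
    | .inr _ => {X.r}
  src t := match t with
    | .inl _ => ∅
    | .inr _ => Set.univ
  tgt _ := ∅
  con t u := match t, u with
    | .inl i, .inl j => X.s i = X.s j
    | .inr _, .inr _ => True
    | _, _ => False

/-- `J` many copies of `X`, with an extra transition from the boundary to each root. -/
abbrev Cp (J : Type) [Finite J] (X : Dat) : NetB 1 0 where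
  P := J × X.P
  T := J × Option X.I
  finP := by haveI := X.finP; exact inferInstance
  finT := by haveI := X.finI; exact inferInstance
  pre t := match t with
    | (j, some i) => {(j, X.s i)}
    | (_, none) => ∅
  post t := match t with
    | (j, some i) => {(j, X.t i)}
    | (j, none) => {(j, X.r)}
  src t := match t with
    | (_, some _) => ∅
    | (_, none) => Set.univ
  tgt _ := ∅
  con t u := match t, u with
    | (j, some i), (j', some i') => j = j' ∧ X.s i = X.s i'
    | (_, none), (_, none) => True
    | _, _ => False

/-- A single place, with a transition out to the right and `b` transitions in from the left. -/
abbrev rootN (b : ℕ) : NetB b 1 where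
  P := Unit
  T := Fin b ⊕ Unit
  finP := inferInstance
  finT := inferInstance
  pre t := match t with
    | .inl _ => ∅
    | .inr _ => Set.univ
  post t := match t with
    | .inl _ => Set.univ
    | .inr _ => ∅
  src t := match t with
    | .inl _ => Set.univ
    | .inr _ => ∅
  tgt t := match t with
    | .inl _ => ∅
    | .inr _ => Set.univ
  con t u := match t, u with
    | .inl _, .inl _ => True
    | .inr _, .inr _ => True
    | _, _ => False

/-- Choice: the left port is connected to each of the right ports by its own transition. -/
abbrev dupN : NetB 1 2 where
  P := Empty
  T := Fin 2
  finP := inferInstance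
  finT := inferInstance
  pre _ := ∅
  post _ := ∅
  src _ := Set.univ
  tgt t := {t}
  con _ _ := True

/-- The empty net of type `1 → 0`. -/
abbrev empN : NetB 1 0 where
  P := Empty
  T := Empty
  finP := inferInstance
  finT := inferInstance
  pre t := t.elim
  post t := t.elim
  src t := t.elim
  tgt t := t.elim
  con t _ := t.elim

/-- A single place with one transition from the left. -/
abbrev leafN : NetB 1 0 where
  P := Unit
  T := Unit
  finP := inferInstance
  finT := inferInstance
  pre _ := ∅
  post _ := Set.univ
  src _ := Set.univ
  tgt _ := ∅
  con _ _ := True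

abbrev Tr (n k : ℕ) : Dat where
  P := {l : List (Fin n) // l.length ≤ k}
  I := {l : List (Fin n) // l.length < k} × Fin n
  finP := (List.finite_length_le (Fin n) k).to_subtype
  finI := (treeL n k).finT
  s t := ⟨t.1.1, t.1.2.le⟩
  t t := ⟨t.1.1 ++ [t.2], by simpa using t.1.2⟩
  r := ⟨[], by simp⟩

theorem leaf_iso (n : ℕ) : Iso leafN (Gb 1 (Tr n 0)) := by
  have hP : ∀ p q : {l : List (Fin n) // l.length ≤ 0}, p = q := by
    rintro ⟨p, hp⟩ ⟨q, hq⟩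
    apply Subtype.ext
    simp only [Nat.le_zero, List.length_eq_zero_iff] at hp hq
    exact hp.trans hq.symm
  have hI : ∀ x : {l : List (Fin n) // l.length < 0} × Fin n, False :=
    fun x => absurd x.1.2 (Nat.not_lt_zero _)
  refine ⟨{ ep := ⟨fun _ => ⟨[], by simp⟩, fun _ => (), fun _ => rfl, fun p => hP _ _⟩
            et := ⟨fun _ => Sum.inr 0, fun _ => (), fun _ => rfl, ?_⟩
            pre_eq := ?_
            post_eq := ?_
            src_eq := fun _ => rfl
            tgt_eq := fun _ => rfl
            con_iff := fun _ _ => Iff.rfl }⟩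
  · rintro (x | x)
    · exact (hI x).elim
    · exact congrArg Sum.inr (Subsingleton.elim _ _)
  · intro t; exact (Set.image_empty _).symm
  · intro t
    ext p
    exact ⟨fun h => ⟨(), trivial, hP _ _⟩, fun _ => hP _ _⟩

theorem emp_iso (J : Type) [Finite J] [IsEmpty J] (X : Dat) : Iso empN (Cp J X) :=
  ⟨{ ep := Equiv.equivOfIsEmpty Empty (J × X.P), et := Equiv.equivOfIsEmpty Empty (J × Option X.I),
     pre_eq := fun t => t.elim, post_eq := fun t => t.elim, src_eq := fun t => t.elim,
     tgt_eq := fun t => t.elim, con_iff := fun t => t.elim }⟩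

theorem cp_iso {J J' : Type} [Finite J] [Finite J'] (e : J ≃ J') (X : Dat) :
    Iso (Cp J X) (Cp J' X) := by
  refine ⟨{ ep := Equiv.prodCongr e (Equiv.refl X.P),
            et := Equiv.prodCongr e (Equiv.refl (Option X.I)),
            pre_eq := ?_, post_eq := ?_, src_eq := ?_, tgt_eq := ?_, con_iff := ?_ }⟩
  · rintro ⟨j, _ | i⟩ <;> simp [Cp]
  · rintro ⟨j, _ | i⟩ <;> simp [Cp]
  · rintro ⟨j, _ | i⟩ <;> simp [Cp]
  · rintro ⟨j, _ | i⟩ <;> simp [Cp]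
  · rintro ⟨j, _ | i⟩ ⟨j', _ | i'⟩ <;> simp [Cp]

theorem tree_iso (n k : ℕ) : Iso (Gb 0 (Tr n k)) (treeL n k) := by
  change Iso (Gb 0 (Tr n k)) (treeA n k)
  refine ⟨{ ep := Equiv.refl _, et := Equiv.sumEmpty _ _,
            pre_eq := ?_, post_eq := ?_, src_eq := ?_, tgt_eq := ?_, con_iff := ?_ }⟩
  · rintro (i | i)
    · ext p; simp [Gb, treeA, Tr]
    · exact i.elim0
  · rintro (i | i)
    · ext p; simp [Gb, treeA, Tr, Subtype.ext_iff]
    · exact i.elim0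
  · rintro (i | i)
    · simp [Gb, treeA]
    · exact i.elim0
  · rintro (i | i)
    · simp [Gb, treeA]
    · exact i.elim0
  · rintro (i | i) (j | j)
    · simp [Gb, treeA, Tr, Subtype.ext_iff]
    all_goals first | exact i.elim0 | exact j.elim0

theorem dup_iso (J : Type) [Finite J] (X : Dat) :
    Iso (comp dupN (tensor (Gb 1 X) (Cp J X))) (Cp (Option J) X) := by
  change Iso (comp dupN (tensorA (Gb 1 X) (Cp J X))) (Cp (Option J) X)
  let e0 : Empty ⊕ (X.P ⊕ J × X.P) ≃ Option J × X.P :=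
    { toFun := fun p => match p with
        | .inr (.inl p) => (none, p)
        | .inr (.inr (j, p)) => (some j, p)
      invFun := fun p => match p with
        | (none, p) => .inr (.inl p)
        | (some j, p) => .inr (.inr (j, p))
      left_inv := by rintro (p | p | ⟨j, p⟩) <;> first | rfl | exact p.elim
      right_inv := by rintro ⟨_ | j, p⟩ <;> rfl }
  let f : Option J × Option X.I → Option (Fin 2) ×
      Option ((X.I ⊕ Fin 1) ⊕ (J × Option X.I)) := fun t => match t with
    | (none, some i) => (none, some (.inl (.inl i)))
    | (none, none) => (some 0, some (.inl (.inr 0)))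
    | (some j, some i) => (none, some (.inr (j, some i)))
    | (some j, none) => (some 1, some (.inr (j, none)))
  let sr : (X.I ⊕ Fin 1) ⊕ (J × Option X.I) → Option (Fin 2) := fun t => match t with
    | .inl (.inl _) => none
    | .inl (.inr _) => some 0
    | .inr (_, some _) => none
    | .inr (_, none) => some 1
  refine comp_iso (M := dupN) (N := tensorA (Gb 1 X) (Cp J X)) (K := Cp (Option J) X)
    (fun u => some u) ?_ sr ?_ e0 f ?_ ?_ ?_ ?_ ?_ ?_ ?_ ?_ ?_ ?_
  · intro u j; simp [dupN, eq_comm]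
  · rintro ((i | i) | ⟨j, _ | i⟩) a <;> fin_cases a <;> simp [tensorA, Gb, Cp, sr] <;> decide
  · rintro ⟨_ | j, _ | i⟩ ⟨_ | j', _ | i'⟩ <;> simp [f]
  · rintro ⟨_ | j, _ | i⟩ <;> simp [f, Valid, sr]
  · rintro ⟨_ | u, _ | ((i | i) | ⟨j, _ | i⟩)⟩ <;> simp only [Valid, sr] <;> intro h
    all_goals try (exfalso; simpa using h)
    · exact ⟨(none, some i), rfl⟩
    · exact ⟨(some j, some i), rfl⟩
    · obtain ⟨a, h1, h2⟩ := h
      refine ⟨(none, none), ?_⟩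
      have : i = 0 := Subsingleton.elim _ _
      simp_all [f]
    · obtain ⟨a, h1, h2⟩ := h
      refine ⟨(some j, none), ?_⟩
      simp_all [f]
  · intro t p; exact p.elim
  · rintro ⟨_ | j, _ | i⟩ (p | ⟨j', p⟩) <;> simp [f, e0, tensorA, Gb, Cp]
  · intro t p; exact p.elim
  · rintro ⟨_ | j, _ | i⟩ (p | ⟨j', p⟩) <;> simp [f, e0, tensorA, Gb, Cp]
  · rintro ⟨_ | j, _ | i⟩ a <;> simp [f, Cp, dupN]
  · intro t a; exact a.elim0
  · rintro ⟨_ | j, _ | i⟩ ⟨_ | j', _ | i'⟩ <;> simp [f, Cp, dupN, tensorA, Gb]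

theorem root_iso (b n k : ℕ) :
    Iso (comp (rootN b) (Cp (Fin n) (Tr n k))) (Gb b (Tr n (k + 1))) := by
  let e0 : Unit ⊕ (Fin n × {l : List (Fin n) // l.length ≤ k}) ≃
      {l : List (Fin n) // l.length ≤ k + 1} :=
    { toFun := fun p => match p with
        | .inl _ => ⟨[], by simp⟩
        | .inr (j, p) => ⟨j :: p.1, by simpa using p.2⟩
      invFun := fun p => match p with
        | ⟨[], _⟩ => .inl ()
        | ⟨j :: p, h⟩ => .inr (j, ⟨p, by simpa using h⟩)
      left_inv := by rintro (p | ⟨j, p⟩) <;> rfl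
      right_inv := by rintro ⟨_ | ⟨j, p⟩, h⟩ <;> rfl }
  let f : ({l : List (Fin n) // l.length < k + 1} × Fin n) ⊕ Fin b → Option (Fin b ⊕ Unit) ×
      Option (Fin n × Option ({l : List (Fin n) // l.length < k} × Fin n)) := fun t => match t with
    | .inl (⟨[], _⟩, i) => (some (.inr ()), some (i, none))
    | .inl (⟨j :: l, h⟩, i) => (none, some (j, some (⟨l, by simpa using h⟩, i)))
    | .inr e => (some (.inl e), none)
  let tg : Fin b ⊕ Unit → Option (Fin 1) := fun t => match t with
    | .inl _ => none
    | .inr _ => some 0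
  let sr : Fin n × Option ({l : List (Fin n) // l.length < k} × Fin n) → Option (Fin 1) :=
    fun t => match t with
    | (_, some _) => none
    | (_, none) => some 0
  refine comp_iso (M := rootN b) (N := Cp (Fin n) (Tr n k)) (K := Gb b (Tr n (k + 1)))
    tg ?_ sr ?_ e0 f ?_ ?_ ?_ ?_ ?_ ?_ ?_ ?_ ?_ ?_
  · rintro (u | u) j <;> simp [rootN, tg, eq_comm, Subsingleton.elim j 0]
  · rintro ⟨i, _ | u⟩ j <;> simp [Cp, sr, eq_comm, Subsingleton.elim j 0]
  · rintro (⟨⟨_ | ⟨j, l⟩, h⟩, i⟩ | e) (⟨⟨_ | ⟨j', l'⟩, h'⟩, i'⟩ | e') <;> simp [f] <;> tauto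
  · rintro (⟨⟨_ | ⟨j, l⟩, h⟩, i⟩ | e) <;> simp [f, Valid, sr, tg]
  · rintro ⟨_ | (u | u), _ | ⟨j, _ | ⟨⟨l, hl⟩, i⟩⟩⟩ <;> simp only [Valid, sr, tg] <;> intro h
    all_goals try (exfalso; simpa using h)
    · exact ⟨.inl (⟨j :: l, by simpa using hl⟩, i), rfl⟩
    · exact ⟨.inr u, rfl⟩
    · exact ⟨.inl (⟨[], by simp⟩, j), rfl⟩
  · rintro (⟨⟨_ | ⟨j, l⟩, h⟩, i⟩ | e) p <;> simp [f, e0, rootN, Gb, Tr]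
  · rintro (⟨⟨_ | ⟨j, l⟩, h⟩, i⟩ | e) ⟨j', p, hp⟩ <;> simp [f, e0, Cp, Gb, Tr]
  · rintro (⟨⟨_ | ⟨j, l⟩, h⟩, i⟩ | e) p <;> simp [f, e0, rootN, Gb, Tr]
  · rintro (⟨⟨_ | ⟨j, l⟩, h⟩, i⟩ | e) ⟨j', p, hp⟩ <;> simp [f, e0, Cp, Gb, Tr]
  · rintro (⟨⟨_ | ⟨j, l⟩, h⟩, i⟩ | e) a <;> simp [f, rootN, Gb]
  · intro t a; exact a.elim0
  · rintro (⟨⟨_ | ⟨j, l⟩, h⟩, i⟩ | e) (⟨⟨_ | ⟨j', l'⟩, h'⟩, i'⟩ | e') <;>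
      simp [f, rootN, Cp, Gb, Tr]

/-! ### The decomposition -/

inductive Vr : Type
  | top | root | dup | emp | leaf

def Asg : Vr → NetS
  | .top => ⟨0, 1, rootN 0⟩
  | .root => ⟨1, 1, rootN 1⟩
  | .dup => ⟨1, 2, dupN⟩
  | .emp => ⟨1, 0, empN⟩
  | .leaf => ⟨1, 0, leafN⟩

theorem asg_con (x : Vr) : IsContention (Asg x).2.2 := by
  have hr : ∀ b, IsContention (rootN b) := by
    intro b
    refine ⟨?_, ?_, ?_⟩
    · rintro (t | t) <;> simp [rootN]
    · rintro (t | t) (u | u) <;> simp [rootN]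
    · rintro (t | t) (u | u) <;> simp [rootN]
  cases x
  · exact hr 0
  · exact hr 1
  · exact ⟨fun _ => trivial, fun _ _ _ => trivial, fun _ _ _ => trivial⟩
  · exact ⟨fun t => t.elim, fun t => t.elim, fun t => t.elim⟩
  · exact ⟨fun _ => trivial, fun _ _ _ => trivial, fun _ _ _ => trivial⟩

theorem seqS_mk {k l m : ℕ} (M : NetB k l) (N : NetB l m) :
    seqS ⟨k, l, M⟩ ⟨l, m, N⟩ = ⟨k, m, comp M N⟩ := by
  simp [seqS, castNet_self]
  rfl

/-- `N` has a decomposition of width two over the assignment `Asg`. -/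
def Good {k l : ℕ} (N : NetB k l) : Prop :=
  ∃ (t : WExpr Vr) (N' : NetB k l), WT Asg t ∧ HasWidth Asg 2 t ∧
    sem Asg t = ⟨k, l, N'⟩ ∧ Iso N' N

theorem Good.iso {k l : ℕ} {N N' : NetB k l} (h : Good N) (i : Iso N N') : Good N' := by
  obtain ⟨t, M, h1, h2, h3, ⟨φ⟩⟩ := h
  obtain ⟨ψ⟩ := i
  exact ⟨t, M, h1, h2, h3, ⟨φ.trans ψ⟩⟩

theorem Good.ofVar {k l : ℕ} {N : NetB k l} (x : Vr) (h : Asg x = ⟨k, l, N⟩)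
    (hk : k ≤ 2) (hl : l ≤ 2) (hP : Nat.card N.P ≤ 2) : Good N := by
  refine ⟨.leaf x, N, trivial, ?_, h, ⟨NetIso.refl N⟩⟩
  simp only [HasWidth]
  rw [h]
  exact ⟨hk, hP, hl⟩

theorem Good.tensor {l m k n : ℕ} {M : NetB l m} {N : NetB k n} (hM : Good M) (hN : Good N)
    (h1 : l + k ≤ 2) (h2 : m + n ≤ 2) : Good (NWB.tensor M N) := by
  obtain ⟨t, M', a1, a2, a3, ⟨φ⟩⟩ := hM
  obtain ⟨u, N', b1, b2, b3, ⟨ψ⟩⟩ := hN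
  have hs : sem Asg (.ten t u) = ⟨l + k, m + n, NWB.tensor M' N'⟩ := by
    simp only [sem, a3, b3]; rfl
  refine ⟨.ten t u, _, ⟨a1, b1⟩, ⟨a2, b2, ?_, ?_⟩, hs, ⟨φ.tensor ψ⟩⟩
  · rw [hs]; exact h1
  · rw [hs]; exact h2

theorem Good.compVar {l m n : ℕ} {M : NetB l m} {N : NetB m n} (x : Vr) (h : Asg x = ⟨l, m, M⟩)
    (hl : l ≤ 2) (hm : m ≤ 2) (hn : n ≤ 2) (hP : Nat.card M.P ≤ 2)
    (hN : Good N) : Good (comp M N) := by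
  obtain ⟨u, N', b1, b2, b3, ⟨ψ⟩⟩ := hN
  have hs : sem Asg (.seq (.leaf x) u) = ⟨l, n, comp M N'⟩ := by
    simp only [sem, h, b3]; exact seqS_mk M N'
  refine ⟨.seq (.leaf x) u, _, ⟨trivial, b1, ?_⟩, ⟨?_, b2, ?_, ?_⟩, hs, ⟨ψ.compRight M⟩⟩
  · rw [b3]; change (Asg x).2.1 = m; rw [h]
  · simp only [HasWidth]
    rw [h]
    exact ⟨hl, hP, hm⟩
  · rw [hs]; exact hl
  · rw [hs]; exact hn

theorem good_cp (X : Dat) (hX : Good (Gb 1 X)) (J : Type) [Finite J] : Good (Cp J X) := by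
  suffices h : ∀ hJ : Finite J, Good (@Cp J hJ X) from h _
  refine Finite.induction_empty_option (P := fun J => ∀ hJ : Finite J, Good (@Cp J hJ X))
    ?_ ?_ ?_ J
  · intro J J' e ih hJ'
    haveI : Finite J := Finite.of_equiv J' e.symm
    exact (ih inferInstance).iso (cp_iso e X)
  · intro hJ
    exact (Good.ofVar (N := empN) .emp rfl (by simp) (by simp)
      (by simp [empN])).iso (emp_iso PEmpty X)
  · intro J _ ih hJ
    exact (Good.compVar (M := dupN) .dup rfl (by simp) (by simp) (by simp) (by simp [dupN])
      (Good.tensor hX (ih inferInstance) (by simp) (by simp))).iso (dup_iso J X)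

theorem good_tr (n k : ℕ) : Good (Gb 1 (Tr n k)) := by
  induction k with
  | zero => exact (Good.ofVar (N := leafN) .leaf rfl (by simp) (by simp)
      (by simp [leafN])).iso (leaf_iso n)
  | succ k ih => exact (Good.compVar (M := rootN 1) .root rfl (by simp) (by simp) (by simp)
      (by simp [rootN]) (good_cp _ ih (Fin n))).iso (root_iso 1 n k)

/-- for all `n, k ≥ 1`, the tree net `T_Λ^{n,k}` has
decomposition width 2. -/
theorem treeL_decompWidth (n k : ℕ) (hn : 1 ≤ n) (hk : 1 ≤ k) :
    HasDecompWidth (treeL n k) 2 := by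
  obtain ⟨k, rfl⟩ : ∃ j, k = j + 1 := ⟨k - 1, by omega⟩
  have h : Good (treeL n (k + 1)) :=
    ((Good.compVar (M := rootN 0) .top rfl (by simp) (by simp) (by simp)
      (by simp [rootN]) (good_cp _ (good_tr n k) (Fin n))).iso (root_iso 0 n k)).iso
      (tree_iso n (k + 1))
  obtain ⟨t, N', h1, h2, h3, h4⟩ := h
  refine ⟨Vr, Asg, t, ⟨asg_con, h1, ?_⟩, h2⟩
  rw [h3]
  exact ⟨rfl, rfl, by rw [castNet_self]; exact h4⟩

end NWB
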